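/- Let (Γ_n) be a sequence of finite connected vertex-transitive graphs of diverging sizes n with uniformly bounded degree satisfying D² = o(n/log n), with f(n) defined by n = D²f(n). Fix k ≥ 1. Then for every t ≥ 0 and every set A of vertices with |A| = k, P_α(T_A > t) = P_π(T_A > t)·(1 + O(1/f(n))), where the implicit constants are uniform in t and in A (among sets of cardinality k), and α = α_A is the quasi-stationary distribution associated with A. -/

import Mathlib

open MeasureTheory Filter

noncomputable section

/-- Heat kernel (transition semigroup) of the continuous-time rate-1 Markov chain with
one-step transition matrix `K`, given by the uniformization formula
`p_t = e^{-t} ∑_k (t^k/k!) K^k`. -/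
def heatKer {V : Type} [Fintype V] [DecidableEq V] (K : Matrix V V ℝ) (t : ℝ) (x y : V) : ℝ :=
  ∑' k : ℕ, Real.exp (-t) * t ^ k / (Nat.factorial k : ℝ) * (K ^ k) x y

/-- A continuous-time Markov chain with jump matrix `K`: a family of path measures `P x`
(for the chain started at `x`), with right-continuous paths, whose finite-dimensional
distributions are given by the heat kernel of `K`. -/
structure CTMC (V : Type) [Fintype V] [DecidableEq V] (K : Matrix V V ℝ) where
  Ω : Type
  mΩ : MeasurableSpace Ω
  P : V → @Measure Ω mΩ
  prob : ∀ x, IsProbabilityMeasure (P x)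
  X : ℝ → Ω → V
  measX : ∀ (t : ℝ) (y : V), MeasurableSet[mΩ] {ω | X t ω = y}
  rightCts : ∀ (ω : Ω) (t : ℝ), ∃ ε > 0, ∀ s, t ≤ s → s < t + ε → X s ω = X t ω
  fdd : ∀ (x : V) (n : ℕ) (t : Fin (n + 1) → ℝ), Monotone t → t 0 = 0 →
    ∀ y : Fin (n + 1) → V,
      P x {ω | ∀ i, X (t i) ω = y i} =
        ENNReal.ofReal ((if y 0 = x then (1 : ℝ) else 0) *
          ∏ i : Fin n, heatKer K (t i.succ - t i.castSucc) (y i.castSucc) (y i.succ))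

namespace CTMC

variable {V : Type} [Fintype V] [DecidableEq V] {K : Matrix V V ℝ}

/-- Hitting time of a set of states. -/
def hit (W : CTMC V K) (A : Set V) (ω : W.Ω) : ℝ :=
  sInf {t : ℝ | 0 ≤ t ∧ W.X t ω ∈ A}

/-- Cover time: the first time every state has been visited. -/
def cov (W : CTMC V K) (ω : W.Ω) : ℝ :=
  sInf {t : ℝ | 0 ≤ t ∧ ∀ y : V, ∃ s, 0 ≤ s ∧ s ≤ t ∧ W.X s ω = y}

/-- The uncovered set at time `t`. -/
def uncov (W : CTMC V K) (t : ℝ) (ω : W.Ω) : Set V :=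
  {y | ∀ s, 0 ≤ s → s ≤ t → W.X s ω ≠ y}

/-- Local time at `y` up to time `t`. -/
def loc (W : CTMC V K) (y : V) (t : ℝ) (ω : W.Ω) : ℝ :=
  ∫ s in (0:ℝ)..t, (if W.X s ω = y then (1 : ℝ) else 0)

/-- Probability of an event for the walk started at `x`. -/
def prx (W : CTMC V K) (x : V) (S : Set W.Ω) : ℝ := (W.P x S).toReal

/-- Expectation of a path functional for the walk started at `x`. -/
def ex (W : CTMC V K) (x : V) (f : W.Ω → ℝ) : ℝ := ∫ ω, f ω ∂(W.P x)

/-- Probability of an event for the walk started from the uniform (stationary) distribution. -/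
def prpi (W : CTMC V K) (S : Set W.Ω) : ℝ :=
  (Fintype.card V : ℝ)⁻¹ * ∑ x : V, W.prx x S

/-- Expectation for the walk started from the uniform (stationary) distribution. -/
def epi (W : CTMC V K) (f : W.Ω → ℝ) : ℝ :=
  (Fintype.card V : ℝ)⁻¹ * ∑ x : V, W.ex x f

/-- Probability for the walk started from the initial distribution `a`. -/
def prw (W : CTMC V K) (a : V → ℝ) (S : Set W.Ω) : ℝ := ∑ x : V, a x * W.prx x S

/-- Expectation for the walk started from the initial distribution `a`. -/
def exw (W : CTMC V K) (a : V → ℝ) (f : W.Ω → ℝ) : ℝ := ∑ x : V, a x * W.ex x f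

end CTMC

/-- Total variation mixing time at level `1/4`. -/
def tmixTV {V : Type} [Fintype V] [DecidableEq V] (K : Matrix V V ℝ) : ℝ :=
  sInf {t : ℝ | 0 ≤ t ∧ ∀ x : V, ∑ y : V, |heatKer K t x y - (Fintype.card V : ℝ)⁻¹| ≤ 1 / 2}

/-- Transition matrix of the simple random walk on a graph. -/
def transMat {V : Type} [Fintype V] [DecidableEq V] (G : SimpleGraph V) [DecidableRel G.Adj] :
    Matrix V V ℝ :=
  Matrix.of fun x y => if G.Adj x y then ((G.degree x : ℝ))⁻¹ else 0

/-- Diameter of a finite graph. -/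
def gDiam {V : Type} [Fintype V] (G : SimpleGraph V) : ℕ :=
  Finset.univ.sup fun p : V × V => G.dist p.1 p.2

/-- Vertex-transitivity of a graph. -/
def IsVertexTransitive {V : Type} (G : SimpleGraph V) : Prop :=
  ∀ x y : V, ∃ φ : SimpleGraph.Iso G G, φ x = y

/-- A finite graph bundled together with a continuous-time rate-1 simple random walk on it. -/
structure GW where
  (V : Type) [fin : Fintype V] [deq : DecidableEq V]
  (G : SimpleGraph V) [adj : DecidableRel G.Adj]
  (W : CTMC V (transMat G))

instance (B : GW) : Fintype B.V := B.fin
instance (B : GW) : DecidableEq B.V := B.deq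
instance (B : GW) : DecidableRel B.G.Adj := B.adj
instance (B : GW) : MeasurableSpace B.W.Ω := B.W.mΩ

/-- Number of vertices. -/
def GW.nV (B : GW) : ℕ := Fintype.card B.V

/-- Diameter. -/
def GW.D (B : GW) : ℕ := gDiam B.G

/-- `f(n)`, defined by `n = D² f(n)`. -/
def GW.fgrowth (B : GW) : ℝ := (B.nV : ℝ) / (B.D : ℝ) ^ 2

/-- Standing assumptions: a sequence of finite connected vertex-transitive graphs with
degrees uniformly bounded by `d`, of diverging sizes, satisfying the diameter condition
`D² = o(n / log n)`. -/
def GoodSeq (B : ℕ → GW) (d : ℕ) : Prop :=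
  (∀ n, (B n).G.Connected) ∧
  (∀ n, IsVertexTransitive (B n).G) ∧
  (∀ n (x : (B n).V), (B n).G.degree x ≤ d) ∧
  Tendsto (fun n => (B n).nV) atTop atTop ∧
  Tendsto (fun n => ((B n).D : ℝ) ^ 2 * Real.log ((B n).nV) / ((B n).nV)) atTop (nhds 0)

/-- The transition matrix of the chain killed upon hitting `A`. -/
def killedMat {V : Type} [Fintype V] [DecidableEq V] (K : Matrix V V ℝ) (A : Finset V) :
    Matrix V V ℝ :=
  Matrix.of fun x y => if x ∈ A ∨ y ∈ A then 0 else K x y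

/-- `a` is the quasi-stationary distribution of `A` with rate `lam`: a probability
distribution supported off `A` which is a left eigenvector of the killed matrix for the
eigenvalue `1 - lam`, where `lam` is the smallest eigenvalue of `I_B - P_B`. -/
structure IsQSD {V : Type} [Fintype V] [DecidableEq V] (K : Matrix V V ℝ) (A : Finset V)
    (a : V → ℝ) (lam : ℝ) : Prop where
  nonneg : ∀ x, 0 ≤ a x
  sum_one : ∑ x : V, a x = 1
  supported : ∀ v ∈ A, a v = 0
  eigen : ∀ y : V, ∑ x : V, a x * killedMat K A x y = (1 - lam) * a y
  minimal : ∀ (mu : ℝ) (g : V → ℝ), g ≠ 0 → (∀ v ∈ A, g v = 0) →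
    (∀ y : V, ∑ x : V, g x * killedMat K A x y = (1 - mu) * g y) → lam ≤ mu

/-- Spectral gap `1 - λ₂` of a reversible transition matrix `K` with stationary
distribution `pd`. -/
def specGap {V : Type} [Fintype V] (K : Matrix V V ℝ) (pd : V → ℝ) : ℝ :=
  sInf {r : ℝ | ∃ g : V → ℝ, g ≠ 0 ∧ (∑ x : V, pd x * g x = 0) ∧
    ∀ y : V, ∑ x : V, K y x * g x = (1 - r) * g y}

/-- Relaxation time of a reversible chain. -/
def trel {V : Type} [Fintype V] (K : Matrix V V ℝ) (pd : V → ℝ) : ℝ := (specGap K pd)⁻¹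

/-- Total variation distance between two Borel measures on `ℝ`. -/
def dTVReal (μ ν : Measure ℝ) : ℝ :=
  ⨆ A : {A : Set ℝ // MeasurableSet A}, |(μ A.1).toReal - (ν A.1).toReal|

/-- The standard Gumbel distribution on `ℝ` (distribution function `s ↦ exp (-e^{-s})`). -/
def gumbelMeasure : Measure ℝ :=
  volume.withDensity fun s => ENNReal.ofReal (Real.exp (-s - Real.exp (-s)))

/-- `ψ(u) = (2/π²) ∑_{k ≥ 1} cos(2πku)/k²`. -/
def psiSeries (u : ℝ) : ℝ :=
  (2 / Real.pi ^ 2) * ∑' k : ℕ, Real.cos (2 * Real.pi * ((k : ℝ) + 1) * u) / ((k : ℝ) + 1) ^ 2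

/-- The cycle graph on `ℤ/mℤ`. -/
def cycleG (m : ℕ) : SimpleGraph (ZMod m) := SimpleGraph.fromRel fun x y => x - y = 1

instance (m : ℕ) : DecidableRel (cycleG m).Adj := fun _ _ => Classical.dec _

section LinearAlgebra

open Matrix

variable {V : Type} [Fintype V]

lemma dotProduct_pow_mulVec_of_vecMul_eq [DecidableEq V] {M : Matrix V V ℝ} {a : V → ℝ} {ρ : ℝ}
    (ha : a ᵥ* M = ρ • a) (N : ℕ) (b : V → ℝ) :
    a ⬝ᵥ (M ^ N *ᵥ b) = ρ ^ N * (a ⬝ᵥ b) := by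
  induction N generalizing b with
  | zero => simp
  | succ N ih =>
    rw [pow_succ, ← mulVec_mulVec, ih, dotProduct_mulVec, ha, smul_dotProduct, smul_eq_mul,
      pow_succ, mul_assoc]

lemma dotProduct_pow_mulVec_self [DecidableEq V] {M : Matrix V V ℝ} (hM : M.IsSymm) (j : ℕ)
    (b : V → ℝ) :
    b ⬝ᵥ (M ^ (j + j) *ᵥ b) = (M ^ j *ᵥ b) ⬝ᵥ (M ^ j *ᵥ b) := by
  rw [pow_add, ← mulVec_mulVec, dotProduct_mulVec, ← mulVec_transpose, (hM.pow j).eq]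

lemma dotProduct_self_nonneg_real (v : V → ℝ) : 0 ≤ v ⬝ᵥ v :=
  Finset.sum_nonneg fun i _ => mul_self_nonneg (v i)

/-- A positive semidefinite form bounded by `ρ` has operator norm at most `ρ`. -/
lemma mulVec_dotProduct_mulVec_le {M : Matrix V V ℝ} (hM : M.IsSymm) {ρ : ℝ} (hρ : 0 < ρ)
    (h0 : ∀ v, 0 ≤ v ⬝ᵥ (M *ᵥ v)) (h1 : ∀ v, v ⬝ᵥ (M *ᵥ v) ≤ ρ * (v ⬝ᵥ v)) (v : V → ℝ) :
    (M *ᵥ v) ⬝ᵥ (M *ᵥ v) ≤ ρ ^ 2 * (v ⬝ᵥ v) := by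
  have hs : ∀ w, v ⬝ᵥ (M *ᵥ w) = (M *ᵥ v) ⬝ᵥ w := fun w => by
    rw [dotProduct_mulVec, ← mulVec_transpose, hM.eq]
  have key := h0 (ρ • v - M *ᵥ v)
  simp only [mulVec_sub, mulVec_smul, sub_dotProduct, dotProduct_sub, smul_dotProduct,
    dotProduct_smul, smul_eq_mul, hs (M *ᵥ v)] at key
  have hc : (M *ᵥ v) ⬝ᵥ (M *ᵥ v) = v ⬝ᵥ (M *ᵥ (M *ᵥ v)) := (hs _).symm
  have h2 := h1 v
  have h3 := h1 (M *ᵥ v)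
  have h4 := mul_le_mul_of_nonneg_left h2 (sq_nonneg ρ)
  have : ρ * ((M *ᵥ v) ⬝ᵥ (M *ᵥ v)) ≤ ρ * (ρ ^ 2 * (v ⬝ᵥ v)) := by nlinarith
  exact le_of_mul_le_mul_left this hρ

lemma dotProduct_pow_mulVec_le [DecidableEq V] {M : Matrix V V ℝ} (hM : M.IsSymm) {ρ : ℝ}
    (hρ : 0 < ρ)
    (h0 : ∀ v, 0 ≤ v ⬝ᵥ (M *ᵥ v)) (h1 : ∀ v, v ⬝ᵥ (M *ᵥ v) ≤ ρ * (v ⬝ᵥ v)) (j : ℕ)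
    (b : V → ℝ) : b ⬝ᵥ (M ^ (j + j) *ᵥ b) ≤ ρ ^ (j + j) * (b ⬝ᵥ b) := by
  rw [dotProduct_pow_mulVec_self hM]
  induction j with
  | zero => simp
  | succ j ih =>
    rw [pow_succ' M, ← mulVec_mulVec]
    refine (mulVec_dotProduct_mulVec_le hM hρ h0 h1 _).trans ?_
    calc ρ ^ 2 * ((M ^ j *ᵥ b) ⬝ᵥ (M ^ j *ᵥ b)) ≤ ρ ^ 2 * (ρ ^ (j + j) * (b ⬝ᵥ b)) := by gcongr
      _ = _ := by ring

end LinearAlgebra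

section Poincare

variable {V : Type} [Fintype V]

/-- The sum of squared increments of `g` over ordered pairs of neighbours. -/
def edgeEnergy (G : SimpleGraph V) [DecidableRel G.Adj] (g : V → ℝ) : ℝ :=
  ∑ x, ∑ y, if G.Adj x y then (g x - g y) ^ 2 else 0

lemma sum_aut_eq {G : SimpleGraph V} (hG : IsVertexTransitive G) [Fintype (G ≃g G)]
    (F : V → ℝ) (u : V) :
    (Fintype.card V : ℝ) * ∑ φ : G ≃g G, F (φ u) =
      (Fintype.card (G ≃g G) : ℝ) * ∑ x, F x := by
  have h1 : ∀ v, ∑ φ : G ≃g G, F (φ v) = ∑ φ : G ≃g G, F (φ u) := by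
    intro v
    obtain ⟨ψ, hψ⟩ := hG v u
    refine Fintype.sum_equiv ⟨fun φ => ψ.symm.trans φ, fun φ => ψ.trans φ, ?_, ?_⟩ _ _ ?_
    · intro φ; ext x; simp
    · intro φ; ext x; simp
    · intro φ
      simp [← hψ]
  calc (Fintype.card V : ℝ) * ∑ φ : G ≃g G, F (φ u)
      = ∑ v, ∑ φ : G ≃g G, F (φ v) := by simp [h1]
    _ = ∑ φ : G ≃g G, ∑ v, F (φ v) := Finset.sum_comm
    _ = ∑ φ : G ≃g G, ∑ v, F v := Finset.sum_congr rfl fun φ _ => Equiv.sum_comp φ.toEquiv F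
    _ = _ := by simp

lemma sum_aut_sq_le_of_walk {V : Type} {G : SimpleGraph V} [Fintype (G ≃g G)] (g : V → ℝ) {S : ℝ}
    (hS : ∀ u v, G.Adj u v → ∑ φ : G ≃g G, (g (φ u) - g (φ v)) ^ 2 ≤ S)
    {u v : V} (p : G.Walk u v) :
    ∑ φ : G ≃g G, (g (φ u) - g (φ v)) ^ 2 ≤ (p.length : ℝ) ^ 2 * S := by
  induction p with
  | nil => simp
  | @cons u v w h p ih =>
    rcases Nat.eq_zero_or_pos p.length with h0 | h0
    · obtain rfl := SimpleGraph.Walk.eq_of_length_eq_zero h0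
      simpa [h0] using hS _ _ h
    · have hl : (0 : ℝ) < p.length := by exact_mod_cast h0
      have h1 := hS u v h
      rw [SimpleGraph.Walk.length_cons]
      push_cast
      set l : ℝ := (p.length : ℝ)
      have hp : ∀ φ : G ≃g G, l * (g (φ u) - g (φ w)) ^ 2 ≤
          l * (l + 1) * (g (φ u) - g (φ v)) ^ 2 + (l + 1) * (g (φ v) - g (φ w)) ^ 2 := by
        intro φ
        nlinarith [sq_nonneg (l * (g (φ u) - g (φ v)) - (g (φ v) - g (φ w)))]
      have hsum := Finset.sum_le_sum fun (φ : G ≃g G) (_ : φ ∈ Finset.univ) => hp φ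
      rw [Finset.sum_add_distrib, ← Finset.mul_sum, ← Finset.mul_sum, ← Finset.mul_sum] at hsum
      refine le_of_mul_le_mul_left ?_ hl
      calc _ ≤ _ := hsum
        _ ≤ l * (l + 1) * S + (l + 1) * (l ^ 2 * S) := by gcongr
        _ = _ := by ring

lemma dist_le_gDiam (G : SimpleGraph V) (x y : V) : G.dist x y ≤ gDiam G :=
  Finset.le_sup (f := fun p : V × V => G.dist p.1 p.2) (Finset.mem_univ (x, y))

/-- The Poincaré inequality for vertex-transitive graphs. -/
lemma sum_sq_sub_le_edgeEnergy {G : SimpleGraph V} [DecidableRel G.Adj] (hc : G.Connected)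
    (hG : IsVertexTransitive G) (g : V → ℝ) :
    ∑ x, ∑ y, (g x - g y) ^ 2 ≤
      (Fintype.card V : ℝ) * (gDiam G : ℝ) ^ 2 * edgeEnergy G g := by
  classical
  have : Finite (G ≃g G) := DFunLike.finite _
  have : Fintype (G ≃g G) := Fintype.ofFinite _
  obtain ⟨x₀⟩ := hc.nonempty
  set n : ℝ := (Fintype.card V : ℝ)
  set a : ℝ := (Fintype.card (G ≃g G) : ℝ)
  have hn : 0 < n := by
    have : Nonempty V := ⟨x₀⟩
    exact Nat.cast_pos.2 Fintype.card_pos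
  have ha : 0 < a := by
    have : Nonempty (G ≃g G) := ⟨SimpleGraph.Iso.refl⟩
    exact Nat.cast_pos.2 Fintype.card_pos
  have hE : 0 ≤ edgeEnergy G g :=
    Finset.sum_nonneg fun x _ => Finset.sum_nonneg fun y _ => by split_ifs <;> positivity
  have hedge : ∀ u v, G.Adj u v →
      ∑ φ : G ≃g G, (g (φ u) - g (φ v)) ^ 2 ≤ a / n * edgeEnergy G g := by
    intro u v huv
    have h := sum_aut_eq hG (fun x => ∑ y, if G.Adj x y then (g x - g y) ^ 2 else 0) u
    have h2 : ∑ φ : G ≃g G, (g (φ u) - g (φ v)) ^ 2 ≤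
        ∑ φ : G ≃g G, ∑ y, if G.Adj (φ u) y then (g (φ u) - g y) ^ 2 else 0 := by
      refine Finset.sum_le_sum fun φ _ => ?_
      have h3 := Finset.single_le_sum
        (f := fun y => if G.Adj (φ u) y then (g (φ u) - g y) ^ 2 else 0)
        (fun y _ => by split_ifs <;> positivity) (Finset.mem_univ (φ v))
      simpa [φ.map_adj_iff, huv] using h3
    refine h2.trans (le_of_eq ?_)
    rw [div_mul_eq_mul_div, eq_div_iff hn.ne', mul_comm]
    exact h
  have hpair : ∀ y, ∑ φ : G ≃g G, (g (φ x₀) - g (φ y)) ^ 2 ≤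
      (gDiam G : ℝ) ^ 2 * (a / n * edgeEnergy G g) := by
    intro y
    obtain ⟨p, hp⟩ := hc.exists_walk_length_eq_dist x₀ y
    refine (sum_aut_sq_le_of_walk g hedge p).trans ?_
    have : (p.length : ℝ) ≤ gDiam G := by
      rw [hp]; exact_mod_cast dist_le_gDiam G x₀ y
    gcongr
  have hsum : n * ∑ y, ∑ φ : G ≃g G, (g (φ x₀) - g (φ y)) ^ 2 =
      a * ∑ x, ∑ y, (g x - g y) ^ 2 := by
    rw [← sum_aut_eq hG (fun x => ∑ y, (g x - g y) ^ 2) x₀, Finset.sum_comm]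
    congr 1
    exact Finset.sum_congr rfl fun φ _ =>
      Equiv.sum_comp φ.toEquiv fun y => (g (φ x₀) - g y) ^ 2
  have hle := Finset.sum_le_sum fun y (_ : y ∈ (Finset.univ : Finset V)) => hpair y
  rw [Finset.sum_const, Finset.card_univ, nsmul_eq_mul] at hle
  refine le_of_mul_le_mul_left ?_ ha
  rw [← hsum]
  calc _ ≤ n * (n * ((gDiam G : ℝ) ^ 2 * (a / n * edgeEnergy G g))) := by gcongr
    _ = _ := by field_simp

end Poincare

section Killed

open Matrix

variable {V : Type} [Fintype V] [DecidableEq V]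

/-- A symmetric stochastic matrix. -/
structure IsSymmStochastic {V : Type} [Fintype V] (K : Matrix V V ℝ) : Prop where
  nonneg : ∀ x y, 0 ≤ K x y
  row_sum : ∀ x, ∑ y, K x y = 1
  symm : K.IsSymm

namespace IsSymmStochastic

variable {K : Matrix V V ℝ}

lemma pow_nonneg (hK : IsSymmStochastic K) (j : ℕ) (x y : V) : 0 ≤ (K ^ j) x y := by
  induction j generalizing x y with
  | zero => rw [pow_zero, Matrix.one_apply]; split_ifs <;> simp
  | succ j ih =>
    rw [pow_succ, Matrix.mul_apply]
    exact Finset.sum_nonneg fun z _ => mul_nonneg (ih x z) (hK.nonneg z y)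

lemma pow_row_sum (hK : IsSymmStochastic K) (j : ℕ) (x : V) : ∑ y, (K ^ j) x y = 1 := by
  induction j generalizing x with
  | zero => simp [Matrix.one_apply]
  | succ j ih =>
    simp_rw [pow_succ, Matrix.mul_apply]
    rw [Finset.sum_comm]
    simp_rw [← Finset.mul_sum, hK.row_sum, mul_one, ih]

lemma pow_le_one (hK : IsSymmStochastic K) (j : ℕ) (x y : V) : (K ^ j) x y ≤ 1 := by
  rw [← hK.pow_row_sum j x]
  exact Finset.single_le_sum (fun z _ => hK.pow_nonneg j x z) (Finset.mem_univ y)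

lemma sum_mul_sq_left {V : Type} [Fintype V] {K : Matrix V V ℝ} (hK : IsSymmStochastic K)
    (g : V → ℝ) :
    ∑ x, ∑ y, K x y * g x ^ 2 = g ⬝ᵥ g := by
  simp_rw [← Finset.sum_mul, hK.row_sum, one_mul, dotProduct, sq]

lemma sum_mul_sq_right {V : Type} [Fintype V] {K : Matrix V V ℝ} (hK : IsSymmStochastic K)
    (g : V → ℝ) :
    ∑ x, ∑ y, K x y * g y ^ 2 = g ⬝ᵥ g := by
  rw [← hK.sum_mul_sq_left g, Finset.sum_comm]
  exact Finset.sum_congr rfl fun x _ => Finset.sum_congr rfl fun y _ => by rw [hK.symm.apply]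

end IsSymmStochastic

variable {K : Matrix V V ℝ} {A : Finset V} {a : V → ℝ} {lam : ℝ}

lemma killedMat_apply (K : Matrix V V ℝ) (A : Finset V) (x y : V) :
    killedMat K A x y = if x ∈ A ∨ y ∈ A then 0 else K x y := rfl

lemma killedMat_isSymm (hK : K.IsSymm) (A : Finset V) : (killedMat K A).IsSymm := by
  ext x y
  simp only [transpose_apply, killedMat_apply, hK.apply, or_comm]

lemma killedMat_nonneg (hK : ∀ x y, 0 ≤ K x y) (x y : V) : 0 ≤ killedMat K A x y := by
  rw [killedMat_apply]; split_ifs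
  exacts [le_rfl, hK x y]

lemma killedMat_le (hK : ∀ x y, 0 ≤ K x y) (x y : V) : killedMat K A x y ≤ K x y := by
  rw [killedMat_apply]; split_ifs
  exacts [hK x y, le_rfl]

lemma killedMat_mulVec_of_mem (g : V → ℝ) {x : V} (hx : x ∈ A) :
    (killedMat K A *ᵥ g) x = 0 := by
  simp [mulVec, dotProduct, killedMat_apply, hx]

namespace IsQSD

lemma dotProduct_self_pos (ha : IsQSD K A a lam) : 0 < a ⬝ᵥ a := by
  refine lt_of_le_of_ne (dotProduct_self_nonneg_real a) fun h => ?_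
  have : a = 0 := dotProduct_self_eq_zero.1 h.symm
  simpa [this] using ha.sum_one

lemma vecMul_killedMat (ha : IsQSD K A a lam) : a ᵥ* killedMat K A = (1 - lam) • a := by
  ext y
  exact ha.eigen y

lemma lam_le_one (ha : IsQSD K A a lam) (hK : ∀ x y, 0 ≤ K x y) : lam ≤ 1 := by
  obtain ⟨y, -, hy⟩ : ∃ y ∈ Finset.univ, 0 < a y := by
    by_contra! h
    have := Finset.sum_nonpos h
    rw [ha.sum_one] at this
    linarith
  have h : 0 ≤ (1 - lam) * a y := by
    rw [← ha.eigen y]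
    exact Finset.sum_nonneg fun x _ => mul_nonneg (ha.nonneg x) (killedMat_nonneg hK x y)
  have := nonneg_of_mul_nonneg_left h hy
  linarith

/-- The variational characterisation of the rate of the quasi-stationary distribution. -/
lemma dotProduct_killedMat_mulVec_le (ha : IsQSD K A a lam) (hK : IsSymmStochastic K)
    (v : V → ℝ) : v ⬝ᵥ (killedMat K A *ᵥ v) ≤ (1 - lam) * (v ⬝ᵥ v) := by
  have hT := killedMat_isSymm hK.symm A
  have hH : ((1 - lam) • (1 : Matrix V V ℝ) - killedMat K A).IsHermitian := by
    rw [IsHermitian, conjTranspose_eq_transpose_of_trivial]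
    simp [hT.eq]
  have hpsd : ((1 - lam) • (1 : Matrix V V ℝ) - killedMat K A).PosSemidef := by
    rw [hH.posSemidef_iff_eigenvalues_nonneg]
    intro i
    rw [Pi.zero_apply]
    set θ := hH.eigenvalues i
    have he := hH.mulVec_eigenvectorBasis i
    have hne : (hH.eigenvectorBasis i).ofLp ≠ 0 := fun h =>
      hH.eigenvectorBasis.orthonormal.ne_zero i (by ext j; simpa using congrFun h j)
    set g := (hH.eigenvectorBasis i).ofLp
    have hg : killedMat K A *ᵥ g = (1 - (lam + θ)) • g := by
      rw [sub_mulVec, smul_mulVec, one_mulVec] at he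
      have h2 : killedMat K A *ᵥ g = (1 - lam) • g - θ • g := by rw [← he]; abel
      rw [h2, ← sub_smul]; congr 1; ring
    by_cases hz : 1 - (lam + θ) = 0
    · have := ha.lam_le_one hK.nonneg
      linarith
    · have hmin := ha.minimal (lam + θ) g hne (fun x hx => by
        have h2 := congrFun hg x
        rw [killedMat_mulVec_of_mem g hx, Pi.smul_apply, smul_eq_mul] at h2
        exact (mul_eq_zero.1 h2.symm).resolve_left hz) (fun y => by
        have h2 := congrFun hg y
        rw [Pi.smul_apply, smul_eq_mul] at h2
        rw [← h2]
        exact Finset.sum_congr rfl fun x _ => by rw [hT.apply, mul_comm])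
      linarith
  have h := hpsd.dotProduct_mulVec_nonneg v
  rw [star_trivial, sub_mulVec, smul_mulVec, one_mulVec, dotProduct_sub, dotProduct_smul,
    smul_eq_mul] at h
  linarith

/-- Testing against the indicator of the complement of `A` bounds the rate. -/
lemma lam_mul_le (ha : IsQSD K A a lam) (hK : IsSymmStochastic K) :
    lam * ((Fintype.card V : ℝ) - A.card) ≤ A.card := by
  set b : V → ℝ := fun x => if x ∈ A then 0 else 1 with hb
  have h := ha.dotProduct_killedMat_mulVec_le hK b
  have hA : ∑ x : V, (if x ∈ A then (1 : ℝ) else 0) = A.card := by simp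
  have hbb : b ⬝ᵥ b = (Fintype.card V : ℝ) - A.card := by
    rw [← hA, ← Finset.card_univ, Finset.card_eq_sum_ones, Nat.cast_sum, ← Finset.sum_sub_distrib]
    refine Finset.sum_congr rfl fun x _ => ?_
    simp only [hb]; split_ifs <;> simp
  have hlow : (Fintype.card V : ℝ) - A.card - A.card ≤ b ⬝ᵥ (killedMat K A *ᵥ b) := by
    have h1 : ∀ x y, K x y - (if x ∈ A then 1 else 0) * K x y -
        (if y ∈ A then 1 else 0) * K y x ≤ b x * (killedMat K A x y * b y) := by
      intro x y
      have := hK.nonneg x y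
      rw [hK.symm.apply x y]
      simp only [hb, killedMat_apply]
      by_cases hx : x ∈ A <;> by_cases hy : y ∈ A <;> simp [hx, hy, this]
    have h2 := Finset.sum_le_sum fun x (_ : x ∈ (Finset.univ : Finset V)) =>
      Finset.sum_le_sum fun y (_ : y ∈ (Finset.univ : Finset V)) => h1 x y
    simp only [Finset.sum_sub_distrib, ← Finset.mul_sum, hK.row_sum] at h2
    rw [Finset.sum_comm (f := fun x y => (if y ∈ A then (1 : ℝ) else 0) * K y x)] at h2
    simp only [← Finset.mul_sum, hK.row_sum, mul_one, hA] at h2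
    have h3 : ∑ x, b x * ∑ y, killedMat K A x y * b y = b ⬝ᵥ (killedMat K A *ᵥ b) := rfl
    simpa [h3] using h2
  rw [hbb] at h
  linarith

/-- The Dirichlet form of a quasi-stationary distribution. -/
lemma sum_mul_sq_sub (ha : IsQSD K A a lam) (hK : IsSymmStochastic K) :
    ∑ x, ∑ y, K x y * (a x - a y) ^ 2 = 2 * lam * (a ⬝ᵥ a) := by
  have h1 : ∑ x, ∑ y, K x y * (a x * a y) = (1 - lam) * (a ⬝ᵥ a) := by
    rw [Finset.sum_comm]
    have : ∀ y, ∑ x, K x y * (a x * a y) = (1 - lam) * (a y * a y) := by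
      intro y
      rw [← mul_assoc, ← ha.eigen y, Finset.sum_mul]
      refine Finset.sum_congr rfl fun x _ => ?_
      by_cases hx : x ∈ A
      · simp [ha.supported x hx]
      · by_cases hy : y ∈ A
        · simp [ha.supported y hy]
        · rw [killedMat_apply, if_neg (by tauto)]; ring
    simp_rw [this, ← Finset.mul_sum]
    rfl
  have h2 : ∀ x y, K x y * (a x - a y) ^ 2 =
      K x y * a x ^ 2 + K x y * a y ^ 2 - 2 * (K x y * (a x * a y)) := fun x y => by ring
  simp_rw [h2, Finset.sum_sub_distrib, Finset.sum_add_distrib, ← Finset.mul_sum]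
  rw [hK.sum_mul_sq_left, hK.sum_mul_sq_right, h1]
  ring

end IsQSD

lemma neg_le_dotProduct_killedMat_mulVec (hK : IsSymmStochastic K) (v : V → ℝ) :
    -(v ⬝ᵥ v) ≤ v ⬝ᵥ (killedMat K A *ᵥ v) := by
  have h1 : ∀ x y, -(K x y * v x ^ 2 + K x y * v y ^ 2) ≤
      2 * (v x * (killedMat K A x y * v y)) := by
    intro x y
    have h0 := killedMat_nonneg (A := A) hK.nonneg x y
    have h2 := mul_le_mul_of_nonneg_right (killedMat_le (A := A) hK.nonneg x y)
      (add_nonneg (sq_nonneg (v x)) (sq_nonneg (v y)))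
    have h3 := mul_nonneg h0 (sq_nonneg (v x + v y))
    linarith
  have h2 := Finset.sum_le_sum fun x (_ : x ∈ (Finset.univ : Finset V)) =>
    Finset.sum_le_sum fun y (_ : y ∈ (Finset.univ : Finset V)) => h1 x y
  simp only [Finset.sum_neg_distrib, Finset.sum_add_distrib, ← Finset.mul_sum] at h2
  rw [hK.sum_mul_sq_left, hK.sum_mul_sq_right] at h2
  have h3 : ∑ x, v x * ∑ y, killedMat K A x y * v y = v ⬝ᵥ (killedMat K A *ᵥ v) := rfl
  rw [h3] at h2
  linarith

end Killed

section SimpleRandomWalk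

open Matrix

variable {V : Type} [Fintype V] [DecidableEq V] {G : SimpleGraph V} [DecidableRel G.Adj]

lemma transMat_apply (G : SimpleGraph V) [DecidableRel G.Adj] (x y : V) :
    transMat G x y = if G.Adj x y then ((G.degree x : ℝ))⁻¹ else 0 := rfl

lemma IsVertexTransitive.degree_eq {V : Type} [Fintype V] {G : SimpleGraph V}
    [DecidableRel G.Adj] (hG : IsVertexTransitive G) (x y : V) :
    G.degree x = G.degree y := by
  obtain ⟨φ, rfl⟩ := hG x y
  exact (φ.degree_eq x).symm

lemma transMat_isSymmStochastic [Nontrivial V] (hc : G.Connected)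
    (hG : IsVertexTransitive G) : IsSymmStochastic (transMat G) where
  nonneg x y := by rw [transMat_apply]; split_ifs <;> positivity
  row_sum x := by
    have h := hc.preconnected.degree_pos_of_nontrivial x
    simp_rw [transMat_apply, ← Finset.sum_filter, Finset.sum_const, nsmul_eq_mul]
    rw [← SimpleGraph.neighborFinset_eq_filter, SimpleGraph.card_neighborFinset_eq_degree]
    field_simp
  symm := by
    ext x y
    simp only [transpose_apply, transMat_apply, G.adj_comm, hG.degree_eq y x]

lemma edgeEnergy_le {d : ℕ} [Nontrivial V] (hc : G.Connected) (hd : ∀ x, G.degree x ≤ d)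
    (g : V → ℝ) :
    edgeEnergy G g ≤ d * ∑ x, ∑ y, transMat G x y * (g x - g y) ^ 2 := by
  simp_rw [edgeEnergy, Finset.mul_sum]
  refine Finset.sum_le_sum fun x _ => Finset.sum_le_sum fun y _ => ?_
  have h : (0 : ℝ) < G.degree x := by
    exact_mod_cast hc.preconnected.degree_pos_of_nontrivial x
  have h2 : (1 : ℝ) ≤ d * (G.degree x : ℝ)⁻¹ := by
    rw [← div_eq_mul_inv, one_le_div h]
    exact_mod_cast hd x
  rw [transMat_apply]
  split_ifs
  · rw [← mul_assoc]
    exact le_mul_of_one_le_left (sq_nonneg _) h2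
  · simp

/-- The `χ²`-distance between the quasi-stationary and the uniform distributions. -/
lemma IsQSD.card_mul_dotProduct_self_le {d : ℕ} [Nontrivial V] (hc : G.Connected)
    (hG : IsVertexTransitive G) (hd : ∀ x, G.degree x ≤ d) {A : Finset V} {a : V → ℝ} {lam : ℝ}
    (ha : IsQSD (transMat G) A a lam) :
    (Fintype.card V : ℝ) * (a ⬝ᵥ a) - 1 ≤
      d * (gDiam G : ℝ) ^ 2 * lam * (Fintype.card V * (a ⬝ᵥ a)) := by
  have h1 := sum_sq_sub_le_edgeEnergy hc hG a
  have h2 := edgeEnergy_le hc hd a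
  rw [ha.sum_mul_sq_sub (transMat_isSymmStochastic hc hG)] at h2
  have h3 : ∑ x, ∑ y, (a x - a y) ^ 2 = 2 * (Fintype.card V * (a ⬝ᵥ a)) - 2 := by
    have : ∀ x y, (a x - a y) ^ 2 = a x * a x + a y * a y - 2 * (a x * a y) :=
      fun x y => by ring
    simp_rw [this, Finset.sum_sub_distrib, Finset.sum_add_distrib, ← Finset.mul_sum,
      ha.sum_one]
    simp only [Finset.sum_const, Finset.card_univ, nsmul_eq_mul, mul_one, ha.sum_one]
    have h4 : ∑ x, a x * (Fintype.card V * a x) = Fintype.card V * ∑ x, a x * a x := by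
      rw [Finset.mul_sum]
      exact Finset.sum_congr rfl fun x _ => by ring
    rw [dotProduct, h4]
    ring
  rw [h3] at h1
  have h4 := mul_le_mul_of_nonneg_left h2
    (by positivity : 0 ≤ (Fintype.card V : ℝ) * (gDiam G : ℝ) ^ 2)
  linarith

/-- A quasi-stationary distribution is not uniform. -/
lemma IsQSD.one_lt_card_mul_dotProduct_self {A : Finset V} (hA : A.Nonempty) {K : Matrix V V ℝ}
    {a : V → ℝ} {lam : ℝ} (ha : IsQSD K A a lam) :
    1 < (Fintype.card V : ℝ) * (a ⬝ᵥ a) := by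
  obtain ⟨z, hz⟩ := hA
  have hn : (0 : ℝ) < Fintype.card V := by
    have : Nonempty V := ⟨z⟩
    exact_mod_cast Fintype.card_pos
  have h : 0 < ∑ x, (a x - (Fintype.card V : ℝ)⁻¹) ^ 2 := by
    refine Finset.sum_pos' (fun x _ => sq_nonneg _) ⟨z, Finset.mem_univ z, ?_⟩
    rw [ha.supported z hz, zero_sub, neg_sq]
    positivity
  have h2 : ∑ x, (a x - (Fintype.card V : ℝ)⁻¹) ^ 2 = a ⬝ᵥ a - (Fintype.card V : ℝ)⁻¹ := by
    have h3 : ∀ x, (a x - (Fintype.card V : ℝ)⁻¹) ^ 2 =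
        a x * a x - 2 * (Fintype.card V : ℝ)⁻¹ * a x + ((Fintype.card V : ℝ)⁻¹) ^ 2 :=
      fun x => by ring
    simp_rw [h3, Finset.sum_add_distrib, Finset.sum_sub_distrib, ← Finset.mul_sum, ha.sum_one]
    simp only [Finset.sum_const, Finset.card_univ, nsmul_eq_mul, dotProduct]
    field_simp
    ring
  rw [h2, sub_pos] at h
  calc (1 : ℝ) = Fintype.card V * (Fintype.card V : ℝ)⁻¹ := by field_simp
    _ < _ := by gcongr

end SimpleRandomWalk

section HeatKernel

open Matrix

variable {V : Type} [Fintype V] [DecidableEq V] {K : Matrix V V ℝ}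

lemma IsSymmStochastic.heatKer_nonneg (hK : IsSymmStochastic K) {h : ℝ} (h0 : 0 ≤ h) (x y : V) :
    0 ≤ heatKer K h x y :=
  tsum_nonneg fun j => mul_nonneg (by positivity) (hK.pow_nonneg j x y)

/-- First order expansion of the heat kernel at time zero. -/
lemma IsSymmStochastic.abs_heatKer_sub_le (hK : IsSymmStochastic K) {h : ℝ} (h0 : 0 ≤ h)
    (h1 : h ≤ 1) (x y : V) :
    |heatKer K h x y - ((1 - h) * (1 : Matrix V V ℝ) x y + h * K x y)| ≤ 3 * h ^ 2 := by
  set f : ℕ → ℝ := fun j => Real.exp (-h) * h ^ j / (Nat.factorial j : ℝ) * (K ^ j) x y with hf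
  set w : ℕ → ℝ := fun j => Real.exp (-h) * (h ^ j / (Nat.factorial j : ℝ)) with hw
  have hws : Summable w := (Real.summable_pow_div_factorial h).mul_left _
  have hw1 : ∑' j, w j = 1 := by
    rw [tsum_mul_left]
    have : ∑' j : ℕ, h ^ j / (Nat.factorial j : ℝ) = Real.exp h := by
      rw [Real.exp_eq_exp_ℝ, NormedSpace.exp_eq_tsum_div]
    rw [this, ← Real.exp_add]
    simp
  have hf0 : ∀ j, 0 ≤ f j := fun j => mul_nonneg (by positivity) (hK.pow_nonneg j x y)
  have hfw : ∀ j, f j ≤ w j := fun j => by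
    simp only [hf, hw, mul_div_assoc]
    exact mul_le_of_le_one_right (by positivity) (hK.pow_le_one j x y)
  have hfs : Summable f := Summable.of_nonneg_of_le hf0 hfw hws
  have hsplit := hfs.sum_add_tsum_nat_add 2
  have htail0 : 0 ≤ ∑' j, f (j + 2) := tsum_nonneg fun j => hf0 _
  have htail1 : ∑' j, f (j + 2) ≤ h ^ 2 := by
    calc ∑' j, f (j + 2) ≤ ∑' j, h ^ 2 * w j := by
          refine Summable.tsum_le_tsum (fun j => (hfw _).trans ?_)
            ((summable_nat_add_iff 2).2 hfs) (hws.mul_left _)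
          simp only [hw]
          have hfac : (Nat.factorial j : ℝ) ≤ Nat.factorial (j + 2) := by
            exact_mod_cast Nat.factorial_le (by omega)
          have hpos : (0 : ℝ) < Nat.factorial j := by exact_mod_cast Nat.factorial_pos j
          calc Real.exp (-h) * (h ^ (j + 2) / (Nat.factorial (j + 2) : ℝ))
              ≤ Real.exp (-h) * (h ^ (j + 2) / (Nat.factorial j : ℝ)) := by gcongr
            _ = _ := by ring
      _ = h ^ 2 := by rw [tsum_mul_left, hw1, mul_one]
  have hheat : heatKer K h x y = Real.exp (-h) * (1 : Matrix V V ℝ) x y +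
      Real.exp (-h) * h * K x y + ∑' j, f (j + 2) := by
    rw [heatKer, ← hsplit, Finset.sum_range_succ, Finset.sum_range_one]
    simp [hf]
  have he := abs_le.1 (Real.abs_exp_sub_one_sub_id_le (x := -h)
    (by rw [abs_neg, abs_of_nonneg h0]; exact h1))
  have he1 : Real.exp (-h) ≤ 1 := Real.exp_le_one_iff.2 (by linarith)
  have hone0 : 0 ≤ (1 : Matrix V V ℝ) x y := by simpa using hK.pow_nonneg 0 x y
  have hone1 : (1 : Matrix V V ℝ) x y ≤ 1 := by simpa using hK.pow_le_one 0 x y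
  have hK0 := hK.nonneg x y
  have hK1 : K x y ≤ 1 := by simpa using hK.pow_le_one 1 x y
  rw [hheat, abs_le]
  set e := Real.exp (-h)
  set u := (1 : Matrix V V ℝ) x y
  have ha : 0 ≤ e - 1 + h := by
    have := Real.add_one_le_exp (-h)
    linarith
  have hb : e - 1 + h ≤ h ^ 2 := by linarith [he.2]
  have hau : 0 ≤ (e - 1 + h) * u := mul_nonneg ha hone0
  have hbu : (e - 1 + h) * u ≤ h ^ 2 := (mul_le_of_le_one_right ha hone1).trans hb
  have hc : 0 ≤ h * (1 - e) * K x y :=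
    mul_nonneg (mul_nonneg h0 (by linarith)) hK0
  have hd : h * (1 - e) * K x y ≤ h ^ 2 := by
    refine (mul_le_of_le_one_right (mul_nonneg h0 (by linarith)) hK1).trans ?_
    nlinarith
  constructor <;> nlinarith

/-- Probability that the chain with kernel `p` avoids `A` at times `0, …, N`. -/
def avoidProb (p : V → V → ℝ) (A : Finset V) : ℕ → V → ℝ
  | 0, x => if x ∈ A then 0 else 1
  | N + 1, x => if x ∈ A then 0 else ∑ y, p x y * avoidProb p A N y

lemma avoidProb_nonneg {p : V → V → ℝ} (hp : ∀ x y, 0 ≤ p x y) (A : Finset V) (N : ℕ) (x : V) :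
    0 ≤ avoidProb p A N x := by
  induction N generalizing x with
  | zero => rw [avoidProb]; split_ifs <;> simp
  | succ N ih =>
    rw [avoidProb]; split_ifs
    exacts [le_rfl, Finset.sum_nonneg fun y _ => mul_nonneg (hp x y) (ih y)]

lemma avoidProb_of_mem (p : V → V → ℝ) {A : Finset V} (N : ℕ) {x : V} (hx : x ∈ A) :
    avoidProb p A N x = 0 := by
  cases N <;> simp [avoidProb, hx]

lemma sum_paths_eq_avoidProb (p : V → V → ℝ) (A : Finset V) (N : ℕ) (x : V) :
    ∑ y : Fin (N + 1) → V, (if ∀ i, y i ∉ A then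
      (if y 0 = x then (1 : ℝ) else 0) * ∏ i : Fin N, p (y i.castSucc) (y i.succ) else 0) =
      avoidProb p A N x := by
  induction N generalizing x with
  | zero =>
    rw [← (Equiv.funUnique (Fin 1) V).symm.sum_comp, Finset.sum_eq_single x]
    · simp [avoidProb, ite_not]
    · intro z _ hz
      simp [hz]
    · simp
  | succ N ih =>
    rw [← (Fin.consEquiv fun _ => V).sum_comp, Fintype.sum_prod_type, avoidProb,
      Finset.sum_eq_single x]
    · simp_rw [← ih, Finset.mul_sum]
      rw [Finset.sum_comm]
      by_cases hx : x ∈ A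
      · simp [hx, Fin.consEquiv, Fin.forall_fin_succ]
      · rw [if_neg hx]
        refine Finset.sum_congr rfl fun y _ => ?_
        rw [Finset.sum_eq_single (y 0)]
        · simp only [Fin.consEquiv, Equiv.coe_fn_mk, Fin.forall_fin_succ (n := N + 1),
            Fin.cons_zero, Fin.cons_succ, Fin.prod_univ_succ (n := N), Fin.castSucc_zero,
            Fin.castSucc_succ, hx]
          by_cases hy : ∀ i, y i ∉ A <;> simp [hy]
        · intro w _ hw
          simp [hw.symm]
        · simp
    · intro z _ hz
      refine Finset.sum_eq_zero fun y _ => ?_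
      simp [Fin.consEquiv, hz]
    · simp

/-- The Euler approximation to the avoidance probabilities. -/
lemma abs_avoidProb_sub_le (hK : IsSymmStochastic K) {h : ℝ} (h0 : 0 ≤ h) (h1 : h ≤ 1)
    (A : Finset V) (hle : ∀ N x, avoidProb (heatKer K h) A N x ≤ 1) (N : ℕ) (x : V) :
    |avoidProb (heatKer K h) A N x -
      (((1 - h) • (1 : Matrix V V ℝ) + h • killedMat K A) ^ N *ᵥ
        fun x => if x ∈ A then 0 else 1) x| ≤ N * (Fintype.card V * (3 * h ^ 2)) := by
  set M := (1 - h) • (1 : Matrix V V ℝ) + h • killedMat K A with hM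
  set b : V → ℝ := fun x => if x ∈ A then 0 else 1 with hb
  induction N generalizing x with
  | zero => simp [avoidProb, hb]
  | succ N ih =>
    rw [pow_succ', ← mulVec_mulVec]
    set F := avoidProb (heatKer K h) A N with hF
    set g := M ^ N *ᵥ b with hg
    have hF0 : ∀ y, 0 ≤ F y := avoidProb_nonneg (fun x y => hK.heatKer_nonneg h0 x y) A N
    have hMF : |avoidProb (heatKer K h) A (N + 1) x - (M *ᵥ F) x| ≤
        Fintype.card V * (3 * h ^ 2) := by
      by_cases hx : x ∈ A
      · rw [avoidProb_of_mem _ _ hx, hM, add_mulVec, Pi.add_apply, smul_mulVec, smul_mulVec,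
          one_mulVec, Pi.smul_apply, Pi.smul_apply, killedMat_mulVec_of_mem _ hx, hF,
          avoidProb_of_mem _ _ hx]
        simp
        positivity
      · rw [avoidProb, if_neg hx, mulVec, dotProduct, ← Finset.sum_sub_distrib]
        refine (Finset.abs_sum_le_sum_abs _ _).trans ?_
        rw [← nsmul_eq_mul, ← Finset.card_univ, ← Finset.sum_const]
        refine Finset.sum_le_sum fun y _ => ?_
        rw [← sub_mul, abs_mul, abs_of_nonneg (hF0 y)]
        by_cases hy : y ∈ A
        · rw [hF, avoidProb_of_mem _ _ hy]
          simp
          positivity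
        · have hMxy : M x y = (1 - h) * (1 : Matrix V V ℝ) x y + h * K x y := by
            simp [hM, killedMat_apply, hx, hy]
          rw [hMxy]
          exact (mul_le_of_le_one_right (abs_nonneg _) (hle N y)).trans
            (hK.abs_heatKer_sub_le h0 h1 x y)
    have hMg : |(M *ᵥ F) x - (M *ᵥ g) x| ≤ N * (Fintype.card V * (3 * h ^ 2)) := by
      have hM0 : ∀ y, 0 ≤ M x y := fun y => by
        simp only [hM, Matrix.add_apply, Matrix.smul_apply, smul_eq_mul]
        have h2 : 0 ≤ (1 : Matrix V V ℝ) x y := by simpa using hK.pow_nonneg 0 x y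
        exact add_nonneg (mul_nonneg (by linarith) h2)
          (mul_nonneg h0 (killedMat_nonneg hK.nonneg x y))
      have hM1 : ∑ y, M x y ≤ 1 := by
        simp only [hM, Matrix.add_apply, Matrix.smul_apply, smul_eq_mul]
        rw [Finset.sum_add_distrib, ← Finset.mul_sum, ← Finset.mul_sum]
        have h2 : ∑ y, (1 : Matrix V V ℝ) x y = 1 := by simpa using hK.pow_row_sum 0 x
        have h3 : ∑ y, killedMat K A x y ≤ 1 := by
          rw [← hK.row_sum x]
          exact Finset.sum_le_sum fun y _ => killedMat_le hK.nonneg x y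
        rw [h2]
        nlinarith
      simp only [mulVec, dotProduct]
      rw [← Finset.sum_sub_distrib]
      refine (Finset.abs_sum_le_sum_abs _ _).trans ?_
      calc ∑ y, |M x y * F y - M x y * g y|
          ≤ ∑ y, M x y * (N * (Fintype.card V * (3 * h ^ 2))) := by
            refine Finset.sum_le_sum fun y _ => ?_
            rw [← mul_sub, abs_mul, abs_of_nonneg (hM0 y)]
            exact mul_le_mul_of_nonneg_left (ih y) (hM0 y)
        _ ≤ _ := by
            rw [← Finset.sum_mul]
            exact mul_le_of_le_one_left (by positivity) hM1
    calc _ ≤ _ := abs_sub_le _ ((M *ᵥ F) x) _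
      _ ≤ _ := add_le_add hMF hMg
      _ = _ := by push_cast; ring

end HeatKernel

section HittingTime

open Matrix

variable {V : Type} [Fintype V] [DecidableEq V] {K : Matrix V V ℝ}

namespace CTMC

/-- The event that `A` is not visited during `[0, t]`. -/
def noHit (W : CTMC V K) (A : Finset V) (t : ℝ) : Set W.Ω :=
  {ω | ∀ s, 0 ≤ s → s ≤ t → W.X s ω ∉ A}

/-- The event that `A` is not visited at the times `0, h, …, N h`. -/
def gridAvoid (W : CTMC V K) (A : Finset V) (h : ℝ) (N : ℕ) : Set W.Ω :=
  {ω | ∀ i : Fin (N + 1), W.X (i * h) ω ∉ A}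

lemma measurableSet_gridAvoid (W : CTMC V K) (A : Finset V) (h : ℝ) (N : ℕ) :
    MeasurableSet[W.mΩ] (W.gridAvoid A h N) := by
  let := W.mΩ
  have : W.gridAvoid A h N =
      ⋂ i : Fin (N + 1), ⋂ y ∈ A, {ω | W.X (i * h) ω = y}ᶜ := by
    ext ω
    simp only [gridAvoid, Set.mem_ofPred_eq, Set.mem_iInter, Set.mem_compl_iff]
    exact forall_congr' fun i => ⟨fun hi y hy he => hi (he ▸ hy), fun hi hA => hi _ hA rfl⟩
  rw [this]
  exact MeasurableSet.iInter fun i => MeasurableSet.iInter fun y =>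
    MeasurableSet.iInter fun _ => (W.measX _ y).compl

lemma measure_gridAvoid (W : CTMC V K) (hK : IsSymmStochastic K) (A : Finset V) {h : ℝ}
    (h0 : 0 ≤ h) (N : ℕ) (x : V) :
    W.P x (W.gridAvoid A h N) = ENNReal.ofReal (avoidProb (heatKer K h) A N x) := by
  let := W.mΩ
  have hset : W.gridAvoid A h N =
      ⋃ y ∈ (Finset.univ.filter fun y : Fin (N + 1) → V => ∀ i, y i ∉ A),
        {ω | ∀ i : Fin (N + 1), W.X (i * h) ω = y i} := by
    ext ω
    simp only [gridAvoid, Set.mem_ofPred_eq, Set.mem_iUnion, Finset.mem_filter, Finset.mem_univ,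
      true_and, exists_prop]
    refine ⟨fun hω => ⟨fun i => W.X (i * h) ω, hω, fun _ => rfl⟩, ?_⟩
    rintro ⟨y, hy, hω⟩ i
    rw [hω i]
    exact hy i
  rw [hset, measure_biUnion_finset, ← sum_paths_eq_avoidProb, ENNReal.ofReal_sum_of_nonneg,
    Finset.sum_filter]
  · refine Finset.sum_congr rfl fun y _ => ?_
    by_cases hy : ∀ i, y i ∉ A
    · rw [if_pos hy, if_pos hy, W.fdd x N (fun i => i * h)
        (fun i j hij => mul_le_mul_of_nonneg_right
          (by exact_mod_cast hij) h0) (by simp)]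
      have hstep : ∀ i : Fin N, ((i.succ : Fin (N + 1)) : ℕ) * h -
          ((i.castSucc : Fin (N + 1)) : ℕ) * h = h := fun i => by
        simp only [Fin.val_succ, Fin.val_castSucc]
        push_cast
        ring
      simp_rw [hstep]
    · rw [if_neg hy, if_neg hy, ENNReal.ofReal_zero]
  · intro y _
    split_ifs
    · exact mul_nonneg zero_le_one (Finset.prod_nonneg fun i _ => hK.heatKer_nonneg h0 _ _)
    · simp
    · exact le_rfl
  · intro y _ z _ hyz
    refine Set.disjoint_left.2 fun ω hy hz => hyz ?_
    ext i
    rw [← hy i, hz i]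
  · intro y _
    have : {ω | ∀ i : Fin (N + 1), W.X (i * h) ω = y i} =
        ⋂ i : Fin (N + 1), {ω | W.X (i * h) ω = y i} := by
      ext ω; simp
    rw [this]
    exact MeasurableSet.iInter fun i => W.measX _ _

lemma prx_gridAvoid (W : CTMC V K) (hK : IsSymmStochastic K) (A : Finset V) {h : ℝ}
    (h0 : 0 ≤ h) (N : ℕ) (x : V) :
    W.prx x (W.gridAvoid A h N) = avoidProb (heatKer K h) A N x := by
  rw [prx, W.measure_gridAvoid hK A h0, ENNReal.toReal_ofReal]
  exact avoidProb_nonneg (fun x y => hK.heatKer_nonneg h0 x y) A N x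

lemma prx_le_one (W : CTMC V K) (x : V) (S : Set W.Ω) : W.prx x S ≤ 1 := by
  let := W.mΩ
  have := W.prob x
  exact ENNReal.toReal_le_of_le_ofReal zero_le_one (by simpa using prob_le_one)

/-- By right-continuity, it suffices to check a fine grid of times. -/
lemma iInter_gridAvoid (W : CTMC V K) (A : Finset V) {t : ℝ} (ht : 0 ≤ t) :
    ⋂ m : ℕ, W.gridAvoid A (t / 2 ^ m) (2 ^ m) = W.noHit A t := by
  ext ω
  simp only [Set.mem_iInter, gridAvoid, noHit, Set.mem_ofPred_eq]
  constructor
  · intro hω s hs hst hA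
    obtain ⟨ε, hε, hX⟩ := W.rightCts ω s
    obtain ⟨m, hm⟩ : ∃ m : ℕ, t / 2 ^ m < ε := by
      have hlim : Tendsto (fun m : ℕ => t / (2 : ℝ) ^ m) atTop (nhds 0) :=
        tendsto_const_nhds.div_atTop (tendsto_pow_atTop_atTop_of_one_lt one_lt_two)
      exact (hlim.eventually (gt_mem_nhds hε)).exists
    set h := t / 2 ^ m with hh
    have hth : (2 : ℝ) ^ m * h = t := by rw [hh]; field_simp
    have hh0 : 0 ≤ h := by positivity
    obtain ⟨i, hi, hsi, his⟩ : ∃ i : ℕ, i ≤ 2 ^ m ∧ s ≤ i * h ∧ i * h < s + ε := by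
      rcases hh0.eq_or_lt with h0 | h0
      · refine ⟨0, Nat.zero_le _, ?_, ?_⟩
        · rw [← h0, mul_zero] at hth
          simp; linarith
        · simp; linarith
      · refine ⟨⌈s / h⌉₊, ?_, ?_, ?_⟩
        · rw [Nat.ceil_le, div_le_iff₀ h0]
          push_cast
          linarith
        · exact (div_le_iff₀ h0).1 (Nat.le_ceil _)
        · have := Nat.ceil_lt_add_one (div_nonneg hs hh0)
          calc (⌈s / h⌉₊ : ℝ) * h < (s / h + 1) * h := by gcongr
            _ = s + h := by field_simp
            _ < s + ε := by linarith
    refine hω m ⟨i, by omega⟩ ?_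
    rw [hX _ hsi his]
    exact hA
  · intro hω m i
    refine hω _ (by positivity) ?_
    have hi : ((i : ℕ) : ℝ) ≤ 2 ^ m := by exact_mod_cast Nat.lt_succ_iff.1 i.2
    calc (i : ℝ) * (t / 2 ^ m) ≤ 2 ^ m * (t / 2 ^ m) := by gcongr
      _ = t := by field_simp

lemma tendsto_prx_gridAvoid (W : CTMC V K) (A : Finset V) {t : ℝ} (ht : 0 ≤ t) (x : V) :
    Tendsto (fun m : ℕ => W.prx x (W.gridAvoid A (t / 2 ^ m) (2 ^ m))) atTop
      (nhds (W.prx x (W.noHit A t))) := by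
  let := W.mΩ
  have := W.prob x
  rw [← W.iInter_gridAvoid A ht]
  refine (ENNReal.tendsto_toReal (measure_ne_top _ _)).comp
    (tendsto_measure_iInter_atTop
      (fun m => (W.measurableSet_gridAvoid A _ _).nullMeasurableSet) ?_
      ⟨0, measure_ne_top _ _⟩)
  refine antitone_nat_of_succ_le fun m ω hω i => ?_
  have h := hω ⟨2 * i, by have := i.2; rw [pow_succ]; omega⟩
  have he : (((2 * (i : ℕ) : ℕ)) : ℝ) * (t / 2 ^ (m + 1)) = (i : ℕ) * (t / 2 ^ m) := by
    push_cast
    rw [pow_succ]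
    field_simp
  rw [he] at h
  exact h

lemma lt_hit_subset_noHit (W : CTMC V K) (A : Finset V) (t : ℝ) :
    {ω | t < W.hit (↑A) ω} ⊆ W.noHit A t := by
  intro ω hω s hs hst hA
  have hω' : t < sInf {t : ℝ | 0 ≤ t ∧ W.X t ω ∈ (A : Set V)} := hω
  have := csInf_le (s := {t : ℝ | 0 ≤ t ∧ W.X t ω ∈ (A : Set V)}) ⟨0, fun r hr => hr.1⟩ ⟨hs, hA⟩
  linarith

/-- On `noHit A t`, either the hitting time exceeds `t` or `A` is never visited. -/
lemma noHit_subset (W : CTMC V K) (A : Finset V) (t : ℝ) :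
    W.noHit A t ⊆ {ω | t < W.hit (↑A) ω} ∪ ⋂ m : ℕ, W.noHit A m := by
  intro ω hω
  by_cases hne : {s : ℝ | 0 ≤ s ∧ W.X s ω ∈ (A : Set V)}.Nonempty
  · left
    set τ := sInf {s : ℝ | 0 ≤ s ∧ W.X s ω ∈ (A : Set V)} with hτ
    have hbdd : BddBelow {s : ℝ | 0 ≤ s ∧ W.X s ω ∈ (A : Set V)} := ⟨0, fun r hr => hr.1⟩
    obtain ⟨ε, hε, hX⟩ := W.rightCts ω τ
    obtain ⟨s, hs, hsε⟩ := exists_lt_of_csInf_lt hne (show τ < τ + ε by linarith)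
    have hτA : W.X τ ω ∈ A := by
      rw [← hX s (csInf_le hbdd hs) hsε]
      exact hs.2
    by_contra hlt
    exact hω τ (le_csInf hne fun r hr => hr.1) (not_lt.1 hlt) hτA
  · right
    refine Set.mem_iInter.2 fun m s hs _ hA => hne ⟨s, hs, hA⟩

lemma prx_lt_hit (W : CTMC V K) (A : Finset V) (x : V)
    (hlim : Tendsto (fun m : ℕ => W.prx x (W.noHit A m)) atTop (nhds 0)) (t : ℝ) :
    W.prx x {ω | t < W.hit (↑A) ω} = W.prx x (W.noHit A t) := by
  let := W.mΩ
  have := W.prob x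
  have hnull : W.P x (⋂ m : ℕ, W.noHit A m) = 0 := by
    have h0 : (W.P x (⋂ m : ℕ, W.noHit A m)).toReal ≤ 0 :=
      ge_of_tendsto' hlim fun m =>
        ENNReal.toReal_mono (measure_ne_top _ _) (measure_mono (Set.iInter_subset _ m))
    have h1 := le_antisymm h0 ENNReal.toReal_nonneg
    exact ((ENNReal.toReal_eq_zero_iff _).1 h1).resolve_right (measure_ne_top _ _)
  have : W.P x {ω | t < W.hit (↑A) ω} = W.P x (W.noHit A t) := by
    refine le_antisymm (measure_mono (W.lt_hit_subset_noHit A t)) ?_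
    calc _ ≤ _ := measure_mono (W.noHit_subset A t)
      _ ≤ _ := measure_union_le _ _
      _ = _ := by rw [hnull, add_zero]
  rw [prx, prx, this]

end CTMC

variable {A : Finset V} {a : V → ℝ} {lam : ℝ}

/-- Convergence of the Euler scheme to the killed semigroup. -/
lemma CTMC.tendsto_euler (W : CTMC V K) (hK : IsSymmStochastic K) (A : Finset V) {t : ℝ}
    (ht : 0 ≤ t) (x : V) :
    Tendsto (fun m : ℕ => (((1 - t / 2 ^ m) • (1 : Matrix V V ℝ) +
      (t / 2 ^ m) • killedMat K A) ^ (2 ^ m) *ᵥ fun x => if x ∈ A then 0 else 1) x) atTop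
      (nhds (W.prx x (W.noHit A t))) := by
  have hlim : Tendsto (fun m : ℕ => t / (2 : ℝ) ^ m) atTop (nhds 0) :=
    tendsto_const_nhds.div_atTop (tendsto_pow_atTop_atTop_of_one_lt one_lt_two)
  have h0 : ∀ m : ℕ, 0 ≤ t / (2 : ℝ) ^ m := fun m => by positivity
  refine (W.tendsto_prx_gridAvoid A ht x).congr_dist ?_
  have hb : Tendsto (fun m : ℕ => (Fintype.card V : ℝ) * 3 * t * (t / 2 ^ m)) atTop (nhds 0) := by
    simpa using hlim.const_mul ((Fintype.card V : ℝ) * 3 * t)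
  refine squeeze_zero' (.of_forall fun m => dist_nonneg) ?_ hb
  filter_upwards [hlim.eventually (gt_mem_nhds zero_lt_one)] with m hm
  rw [Real.dist_eq, W.prx_gridAvoid hK A (h0 m)]
  refine (abs_avoidProb_sub_le hK (h0 m) hm.le A (fun N y => ?_) (2 ^ m) x).trans_eq ?_
  · rw [← W.prx_gridAvoid hK A (h0 m)]
    exact W.prx_le_one y _
  · push_cast
    field_simp

lemma IsQSD.vecMul_euler (ha : IsQSD K A a lam) (h : ℝ) :
    a ᵥ* ((1 - h) • (1 : Matrix V V ℝ) + h • killedMat K A) = (1 - lam * h) • a := by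
  rw [vecMul_add, vecMul_smul, vecMul_smul, vecMul_one, ha.vecMul_killedMat, smul_smul,
    ← add_smul]
  congr 1
  ring

lemma IsQSD.dotProduct_indicator (ha : IsQSD K A a lam) :
    a ⬝ᵥ (fun x => if x ∈ A then (0 : ℝ) else 1) = 1 := by
  refine Eq.trans ?_ ha.sum_one
  refine Finset.sum_congr rfl fun x _ => ?_
  dsimp only
  split_ifs with hx
  · rw [ha.supported x hx, zero_mul]
  · rw [mul_one]

lemma eulerMat_isSymm (hK : K.IsSymm) (A : Finset V) (h : ℝ) :
    ((1 - h) • (1 : Matrix V V ℝ) + h • killedMat K A).IsSymm :=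
  (isSymm_one.smul _).add ((killedMat_isSymm hK A).smul _)

lemma dotProduct_euler_mulVec (A : Finset V) (h : ℝ) (v : V → ℝ) :
    v ⬝ᵥ (((1 - h) • (1 : Matrix V V ℝ) + h • killedMat K A) *ᵥ v) =
      (1 - h) * (v ⬝ᵥ v) + h * (v ⬝ᵥ (killedMat K A *ᵥ v)) := by
  rw [add_mulVec, smul_mulVec, smul_mulVec, one_mulVec, dotProduct_add, dotProduct_smul,
    dotProduct_smul, smul_eq_mul, smul_eq_mul]

lemma euler_pow_mulVec_of_mem (h : ℝ) (N : ℕ) {x : V} (hx : x ∈ A) :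
    (((1 - h) • (1 : Matrix V V ℝ) + h • killedMat K A) ^ N *ᵥ
      fun x => if x ∈ A then 0 else 1) x = 0 := by
  induction N with
  | zero => simp [hx]
  | succ N ih =>
    rw [pow_succ', ← mulVec_mulVec, add_mulVec, Pi.add_apply, smul_mulVec, smul_mulVec,
      one_mulVec, Pi.smul_apply, Pi.smul_apply, ih, killedMat_mulVec_of_mem _ hx]
    simp

lemma sum_euler_eq (h : ℝ) (N : ℕ) :
    ∑ x, (((1 - h) • (1 : Matrix V V ℝ) + h • killedMat K A) ^ N *ᵥ
      fun x => if x ∈ A then 0 else 1) x =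
    (fun x => if x ∈ A then (0 : ℝ) else 1) ⬝ᵥ
      (((1 - h) • (1 : Matrix V V ℝ) + h • killedMat K A) ^ N *ᵥ
        fun x => if x ∈ A then 0 else 1) := by
  refine Finset.sum_congr rfl fun x _ => ?_
  by_cases hx : x ∈ A
  · rw [euler_pow_mulVec_of_mem h N hx, mul_zero]
  · beta_reduce
    rw [if_neg hx, one_mul]

lemma IsQSD.euler_upper (ha : IsQSD K A a lam) (hK : IsSymmStochastic K) {h : ℝ} (h0 : 0 ≤ h)
    (h1 : h ≤ 1 / 2) (j : ℕ) :
    ∑ x, (((1 - h) • (1 : Matrix V V ℝ) + h • killedMat K A) ^ (j + j) *ᵥ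
      fun x => if x ∈ A then 0 else 1) x ≤ (Fintype.card V : ℝ) * (1 - lam * h) ^ (j + j) := by
  have hlam := ha.lam_le_one hK.nonneg
  have hρ : 0 < 1 - lam * h := by nlinarith
  rw [sum_euler_eq, mul_comm]
  refine (dotProduct_pow_mulVec_le (eulerMat_isSymm hK.symm A h) hρ (fun v => ?_) (fun v => ?_)
    j _).trans ?_
  · rw [dotProduct_euler_mulVec]
    have h2 := mul_le_mul_of_nonneg_left (neg_le_dotProduct_killedMat_mulVec (A := A) hK v) h0
    nlinarith [dotProduct_self_nonneg_real v]
  · rw [dotProduct_euler_mulVec]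
    have h2 := mul_le_mul_of_nonneg_left (ha.dotProduct_killedMat_mulVec_le hK v) h0
    linarith
  · refine mul_le_mul_of_nonneg_left ?_ (by positivity)
    rw [← Finset.card_univ, Finset.card_eq_sum_ones, Nat.cast_sum]
    refine Finset.sum_le_sum fun x _ => ?_
    dsimp only
    split_ifs <;> simp

lemma IsQSD.euler_lower (ha : IsQSD K A a lam) (hK : IsSymmStochastic K) (h : ℝ) (j : ℕ) :
    (1 - lam * h) ^ (j + j) ≤ (a ⬝ᵥ a) *
    ∑ x, (((1 - h) • (1 : Matrix V V ℝ) + h • killedMat K A) ^ (j + j) *ᵥ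
      fun x => if x ∈ A then 0 else 1) x := by
  rw [sum_euler_eq, dotProduct_pow_mulVec_self (eulerMat_isSymm hK.symm A h)]
  set v := ((1 - h) • (1 : Matrix V V ℝ) + h • killedMat K A) ^ j *ᵥ
    fun x => if x ∈ A then 0 else 1 with hv
  have h1 : a ⬝ᵥ v = (1 - lam * h) ^ j := by
    rw [hv, dotProduct_pow_mulVec_of_vecMul_eq (ha.vecMul_euler h), ha.dotProduct_indicator,
      mul_one]
  have h2 := Finset.sum_mul_sq_le_sq_mul_sq Finset.univ a v
  simp only [sq] at h2
  rw [pow_add, ← h1]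
  exact h2

namespace CTMC

variable {t : ℝ}

lemma tendsto_rate_pow (W : CTMC V K) (ha : IsQSD K A a lam) (hK : IsSymmStochastic K)
    (ht : 0 ≤ t) :
    Tendsto (fun m : ℕ => (1 - lam * (t / 2 ^ (m + 1))) ^ (2 ^ m + 2 ^ m)) atTop
      (nhds (W.prw a (W.noHit A t))) := by
  have h := tendsto_finsetSum Finset.univ
    fun x _ => ((W.tendsto_euler hK A ht x).comp (tendsto_add_atTop_nat 1)).const_mul (a x)
  refine h.congr fun m => ?_
  have h2 := dotProduct_pow_mulVec_of_vecMul_eq (ha.vecMul_euler (t / 2 ^ (m + 1))) (2 ^ (m + 1))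
    (fun x => if x ∈ A then (0 : ℝ) else 1)
  rw [ha.dotProduct_indicator, mul_one] at h2
  rw [← mul_two, ← pow_succ, ← h2]
  rfl

lemma tendsto_sum_euler (W : CTMC V K) (hK : IsSymmStochastic K) (A : Finset V) (ht : 0 ≤ t) :
    Tendsto (fun m : ℕ => ∑ x, (((1 - t / 2 ^ (m + 1)) • (1 : Matrix V V ℝ) +
      (t / 2 ^ (m + 1)) • killedMat K A) ^ (2 ^ m + 2 ^ m) *ᵥ
        fun x => if x ∈ A then 0 else 1) x) atTop (nhds (∑ x, W.prx x (W.noHit A t))) := by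
  refine (tendsto_finsetSum Finset.univ
    fun x _ => ((W.tendsto_euler hK A ht x).comp (tendsto_add_atTop_nat 1))).congr fun m => ?_
  rw [← mul_two, ← pow_succ]
  rfl

lemma eventually_step_le (t : ℝ) : ∀ᶠ m : ℕ in atTop, t / (2 : ℝ) ^ (m + 1) ≤ 1 / 2 := by
  have hlim : Tendsto (fun m : ℕ => t / (2 : ℝ) ^ (m + 1)) atTop (nhds 0) :=
    (tendsto_const_nhds.div_atTop (tendsto_pow_atTop_atTop_of_one_lt one_lt_two)).comp
      (tendsto_add_atTop_nat 1)
  exact (hlim.eventually (gt_mem_nhds one_half_pos)).mono fun m hm => hm.le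

lemma sum_prx_noHit_le (W : CTMC V K) (ha : IsQSD K A a lam) (hK : IsSymmStochastic K)
    (ht : 0 ≤ t) :
    ∑ x, W.prx x (W.noHit A t) ≤ Fintype.card V * W.prw a (W.noHit A t) := by
  refine le_of_tendsto_of_tendsto (W.tendsto_sum_euler hK A ht)
    ((W.tendsto_rate_pow ha hK ht).const_mul _) ?_
  filter_upwards [eventually_step_le t] with m hm
  exact ha.euler_upper hK (by positivity) hm (2 ^ m)

lemma prw_noHit_le (W : CTMC V K) (ha : IsQSD K A a lam) (hK : IsSymmStochastic K)
    (ht : 0 ≤ t) :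
    W.prw a (W.noHit A t) ≤ (a ⬝ᵥ a) * ∑ x, W.prx x (W.noHit A t) :=
  le_of_tendsto_of_tendsto' (W.tendsto_rate_pow ha hK ht)
    ((W.tendsto_sum_euler hK A ht).const_mul _) fun m => ha.euler_lower hK _ (2 ^ m)

lemma prw_noHit_le_exp (W : CTMC V K) (ha : IsQSD K A a lam) (hK : IsSymmStochastic K)
    (ht : 0 ≤ t) : W.prw a (W.noHit A t) ≤ Real.exp (-(lam * t)) := by
  refine le_of_tendsto (W.tendsto_rate_pow ha hK ht) ?_
  filter_upwards [eventually_step_le t] with m hm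
  have hlam := ha.lam_le_one hK.nonneg
  have h0 : 0 ≤ t / (2 : ℝ) ^ (m + 1) := by positivity
  set h := t / (2 : ℝ) ^ (m + 1) with hh
  have hth : (2 : ℝ) ^ (m + 1) * h = t := by rw [hh]; field_simp
  calc (1 - lam * h) ^ (2 ^ m + 2 ^ m) ≤ Real.exp (-(lam * h)) ^ (2 ^ m + 2 ^ m) := by
        refine pow_le_pow_left₀ (by nlinarith) ?_ _
        have := Real.add_one_le_exp (-(lam * h))
        linarith
    _ = Real.exp (-(lam * t)) := by
        rw [← Real.exp_nat_mul, ← hth]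
        congr 1
        push_cast
        ring

lemma prx_nonneg (W : CTMC V K) (x : V) (S : Set W.Ω) : 0 ≤ W.prx x S := ENNReal.toReal_nonneg

lemma prx_lt_hit_eq (W : CTMC V K) (ha : IsQSD K A a lam) (hK : IsSymmStochastic K)
    (hlam : 0 < lam) (x : V) (t : ℝ) :
    W.prx x {ω | t < W.hit (↑A) ω} = W.prx x (W.noHit A t) := by
  refine W.prx_lt_hit A x ?_ t
  have hexp : Tendsto (fun m : ℕ => (Fintype.card V : ℝ) * Real.exp (-(lam * m))) atTop
      (nhds 0) := by
    simpa using (Real.tendsto_exp_neg_atTop_nhds_zero.comp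
      (tendsto_natCast_atTop_atTop.const_mul_atTop hlam)).const_mul (Fintype.card V : ℝ)
  refine squeeze_zero (fun m => W.prx_nonneg x _) (fun m => ?_) hexp
  calc W.prx x (W.noHit A m) ≤ ∑ x, W.prx x (W.noHit A m) :=
        Finset.single_le_sum (fun y _ => W.prx_nonneg y _) (Finset.mem_univ x)
    _ ≤ Fintype.card V * W.prw a (W.noHit A m) := W.sum_prx_noHit_le ha hK m.cast_nonneg
    _ ≤ _ := by
      gcongr
      exact W.prw_noHit_le_exp ha hK m.cast_nonneg

/-- The two tails agree up to the `χ²`-distance between the initial distributions. -/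
lemma abs_prw_sub_prpi_le [Nonempty V] (W : CTMC V K) (ha : IsQSD K A a lam)
    (hK : IsSymmStochastic K) (hlam : 0 < lam) (ht : 0 ≤ t) :
    |W.prw a {ω | t < W.hit (↑A) ω} - W.prpi {ω | t < W.hit (↑A) ω}| ≤
      (Fintype.card V * (a ⬝ᵥ a) - 1) * W.prpi {ω | t < W.hit (↑A) ω} := by
  have h1 : W.prw a {ω | t < W.hit (↑A) ω} = W.prw a (W.noHit A t) := by
    simp only [prw, W.prx_lt_hit_eq ha hK hlam]
  have h2 : W.prpi {ω | t < W.hit (↑A) ω} = W.prpi (W.noHit A t) := by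
    simp only [prpi, W.prx_lt_hit_eq ha hK hlam]
  have hn : (0 : ℝ) < Fintype.card V := Nat.cast_pos.2 Fintype.card_pos
  have h3 : ∑ x, W.prx x (W.noHit A t) = Fintype.card V * W.prpi (W.noHit A t) := by
    rw [prpi, mul_inv_cancel_left₀ hn.ne']
  have hup := W.sum_prx_noHit_le ha hK ht
  have hlow := W.prw_noHit_le ha hK ht
  rw [h3] at hup hlow
  have hle := le_of_mul_le_mul_left hup hn
  rw [h1, h2, abs_of_nonneg (sub_nonneg.2 hle)]
  linarith

end CTMC

end HittingTime

section Growth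

open Matrix

variable {V : Type} [Fintype V] [DecidableEq V]

/-- For large graphs of moderate diameter, the `χ²`-distance between the quasi-stationary and
the uniform distributions is of order `D² / n`. -/
lemma IsQSD.rate_pos_and_chiSq_le {G : SimpleGraph V} [DecidableRel G.Adj] [Nontrivial V] {d : ℕ}
    (hc : G.Connected) (hG : IsVertexTransitive G) (hd : ∀ x, G.degree x ≤ d) {A : Finset V}
    (hA : A.Nonempty) (hcard : 2 * (A.card : ℝ) ≤ Fintype.card V)
    (hD : 4 * (d : ℝ) * A.card * (gDiam G : ℝ) ^ 2 ≤ Fintype.card V) {a : V → ℝ} {lam : ℝ}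
    (ha : IsQSD (transMat G) A a lam) :
    0 < lam ∧ (Fintype.card V : ℝ) * (a ⬝ᵥ a) - 1 ≤
      4 * (d : ℝ) * A.card * (gDiam G : ℝ) ^ 2 / Fintype.card V := by
  have h1 := ha.one_lt_card_mul_dotProduct_self hA
  have h2 := ha.card_mul_dotProduct_self_le hc hG hd
  have h3 := ha.lam_mul_le (transMat_isSymmStochastic hc hG)
  set n : ℝ := (Fintype.card V : ℝ)
  set k : ℝ := (A.card : ℝ)
  set q := n * (a ⬝ᵥ a)
  set c : ℝ := (d : ℝ) * (gDiam G : ℝ) ^ 2 with hcdef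
  have hn : 0 < n := Nat.cast_pos.2 Fintype.card_pos
  have hc0 : 0 ≤ c := by positivity
  have hlam : 0 < lam := by
    by_contra! hneg
    have : c * lam * q ≤ 0 :=
      mul_nonpos_of_nonpos_of_nonneg (mul_nonpos_of_nonneg_of_nonpos hc0 hneg) (by linarith)
    linarith
  have hlam2 : lam * n ≤ 2 * k := by nlinarith
  have hck : 4 * (d : ℝ) * k * (gDiam G : ℝ) ^ 2 = 4 * (c * k) := by rw [hcdef]; ring
  rw [hck] at hD ⊢
  refine ⟨hlam, ?_⟩
  have hcl : c * lam ≤ 2 * (c * k) / n := by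
    rw [le_div_iff₀ hn]
    nlinarith
  have hhalf : 2 * (c * k) / n ≤ 1 / 2 := by
    rw [div_le_iff₀ hn]
    linarith
  have hq2 : q ≤ 2 := by nlinarith
  calc q - 1 ≤ c * lam * q := h2
    _ ≤ 2 * (c * k) / n * 2 := by gcongr
    _ = _ := by ring

lemma GoodSeq.eventually_diam_sq_le {B : ℕ → GW} {d : ℕ} (hB : GoodSeq B d) (c : ℝ) :
    ∀ᶠ n in atTop, c * ((B n).D : ℝ) ^ 2 ≤ (B n).nV := by
  obtain ⟨-, -, -, hn, hD⟩ := hB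
  have hc : 0 < (|c| + 1)⁻¹ := by positivity
  filter_upwards [hD.eventually (gt_mem_nhds hc), hn.eventually_ge_atTop 3] with n h1 h2
  have h3 : (3 : ℝ) ≤ (B n).nV := by exact_mod_cast h2
  have hlog : 1 ≤ Real.log (B n).nV := by
    rw [Real.le_log_iff_exp_le (by linarith)]
    have := Real.exp_one_lt_d9
    linarith
  rw [div_lt_iff₀ (by linarith), inv_mul_eq_div, lt_div_iff₀ (by positivity)] at h1
  have h4 : ((B n).D : ℝ) ^ 2 ≤ ((B n).D : ℝ) ^ 2 * Real.log (B n).nV :=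
    le_mul_of_one_le_right (by positivity) hlog
  calc c * ((B n).D : ℝ) ^ 2 ≤ (|c| + 1) * ((B n).D : ℝ) ^ 2 := by
        gcongr
        linarith [le_abs_self c]
    _ ≤ (|c| + 1) * (((B n).D : ℝ) ^ 2 * Real.log (B n).nV) := by gcongr
    _ ≤ _ := by linarith

end Growth

/-- Lemma 2.8: uniformly over `t ≥ 0` and over sets `A` of cardinality
`k`, `P_α(T_A > t) = P_π(T_A > t)(1 + O(1/f(n)))`, where `α` is the quasi-stationary
distribution associated with `A`. -/
theorem stationary_vs_quasistationary_tail
    (B : ℕ → GW) (d : ℕ) (hB : GoodSeq B d) (k : ℕ) (hk1 : 1 ≤ k) :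
    ∃ C : ℝ, 0 < C ∧ ∃ N : ℕ, ∀ n ≥ N, ∀ t : ℝ, 0 ≤ t →
      ∀ A : Finset (B n).V, A.card = k →
        ∀ (a : (B n).V → ℝ) (lam : ℝ), IsQSD (transMat (B n).G) A a lam →
          |(B n).W.prw a {ω | t < (B n).W.hit ↑A ω} -
              (B n).W.prpi {ω | t < (B n).W.hit ↑A ω}| ≤
            C * (B n).W.prpi {ω | t < (B n).W.hit ↑A ω} / (B n).fgrowth := by
  obtain ⟨N, hN⟩ := eventually_atTop.1 ((hB.eventually_diam_sq_le (4 * d * k)).and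
    (hB.2.2.2.1.eventually_ge_atTop (2 * k)))
  refine ⟨4 * d * k + 1, by positivity, N, fun n hn t ht A hA a lam ha => ?_⟩
  obtain ⟨hD, hcard⟩ := hN n hn
  have hcard' : 2 * k ≤ Fintype.card (B n).V := hcard
  have : Nontrivial (B n).V := Fintype.one_lt_card_iff_nontrivial.1 (by omega)
  have hc := hB.1 n
  have hG := hB.2.1 n
  obtain ⟨hlam, hchi⟩ := ha.rate_pos_and_chiSq_le hc hG (hB.2.2.1 n)
    (Finset.card_pos.1 (by omega)) (by rw [hA]; exact_mod_cast hcard') (by rw [hA]; exact hD)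
  rw [hA] at hchi
  refine ((B n).W.abs_prw_sub_prpi_le ha (transMat_isSymmStochastic hc hG) hlam ht).trans ?_
  have hP : 0 ≤ (B n).W.prpi {ω | t < (B n).W.hit ↑A ω} :=
    mul_nonneg (by positivity) (Finset.sum_nonneg fun x _ => (B n).W.prx_nonneg x _)
  set P := (B n).W.prpi {ω | t < (B n).W.hit ↑A ω}
  have hf : (4 * d * k + 1) * P / (B n).fgrowth =
      (4 * d * k + 1) * (gDiam (B n).G : ℝ) ^ 2 / Fintype.card (B n).V * P := by
    rw [GW.fgrowth, GW.nV, GW.D, div_div_eq_mul_div]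
    ring
  rw [hf]
  refine mul_le_mul_of_nonneg_right (hchi.trans ?_) hP
  gcongr
  linarith
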